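/- For the zero-one loss on binary labels, the Gibbs risk of a posterior ρ decomposes into half the expected disagreement plus the expected joint error: for any distribution 𝒟 on X × Y with Y = {−1,1} and any probability distribution ρ on a hypothesis class H of measurable functions X → Y, E_{h∼ρ} R_𝒟(h) = (1/2)·d_{𝒟_x}(ρ) + e_𝒟(ρ). -/

import Mathlib

open MeasureTheory ProbabilityTheory

noncomputable section

/-- Binary label space `Y = {-1, 1}`. -/
abbrev Ypm : Type := ({-1, 1} : Set ℤ)

/-- The zero-one loss. -/
def loss01 {Y : Type*} [DecidableEq Y] (y y' : Y) : ℝ := if y = y' then 0 else 1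

/-- The (expected) risk of a hypothesis under a distribution on `X × Y` with zero-one loss. -/
def risk01 {X : Type*} [MeasurableSpace X] (D : Measure (X × Ypm)) (h : X → Ypm) : ℝ :=
  ∫ p, loss01 (h p.1) p.2 ∂D

theorem loss01_nonneg {Y : Type*} [DecidableEq Y] (y y' : Y) : 0 ≤ loss01 y y' := by
  unfold loss01; split_ifs <;> norm_num

theorem loss01_le_one {Y : Type*} [DecidableEq Y] (y y' : Y) : loss01 y y' ≤ 1 := by
  unfold loss01; split_ifs <;> norm_num

/-- Two binary labels disagree exactly when one and only one of them differs from a third. -/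
theorem loss01_eq_add_sub (a b y : Ypm) :
    loss01 a b = loss01 a y + loss01 b y - 2 * (loss01 a y * loss01 b y) := by
  obtain ⟨a, ha⟩ := a
  obtain ⟨b, hb⟩ := b
  obtain ⟨y, hy⟩ := y
  simp only [Set.mem_insert_iff, Set.mem_singleton_iff] at ha hb hy
  rcases ha with rfl | rfl <;> rcases hb with rfl | rfl <;> rcases hy with rfl | rfl <;>
    norm_num [loss01]

theorem Measurable.loss01 {Ω : Type*} [MeasurableSpace Ω] {u v : Ω → Ypm}
    (hu : Measurable u) (hv : Measurable v) : Measurable fun ω => loss01 (u ω) (v ω) :=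
  (measurable_of_countable fun q : Ypm × Ypm => _root_.loss01 q.1 q.2).comp (hu.prodMk hv)

theorem integrable_of_mem_Icc {Ω : Type*} [MeasurableSpace Ω] {μ : Measure Ω}
    [IsFiniteMeasure μ] {g : Ω → ℝ} (hg : Measurable g) (h0 : ∀ ω, 0 ≤ g ω)
    (h1 : ∀ ω, g ω ≤ 1) : Integrable g μ :=
  .of_bound hg.aestronglyMeasurable 1 <| .of_forall fun ω => by
    rw [Real.norm_of_nonneg (h0 ω)]; exact h1 ω

theorem integral_add_sub_two_mul {Ω : Type*} [MeasurableSpace Ω] {μ : Measure Ω}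
    {u v w : Ω → ℝ} (hu : Integrable u μ) (hv : Integrable v μ) (hw : Integrable w μ) :
    ∫ ω, (u ω + v ω - 2 * w ω) ∂μ = ∫ ω, u ω ∂μ + ∫ ω, v ω ∂μ - 2 * ∫ ω, w ω ∂μ := by
  rw [← integral_add hu hv, ← integral_const_mul]
  exact integral_sub (hu.add hv) (hw.const_mul 2)

/-- **Decomposition of the zero-one Gibbs risk.**
For the zero-one loss on binary labels, the Gibbs risk of a posterior `ρ` decomposes into
half the expected disagreement plus the expected joint error:
`E_{h∼ρ} R_𝒟(h) = (1/2) d_{𝒟ₓ}(ρ) + e_𝒟(ρ)`. -/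
theorem gibbs_risk_decomposition
    {X H : Type*} [MeasurableSpace X] [MeasurableSpace H]
    (f : H → X → Ypm) (hf : Measurable fun p : H × X => f p.1 p.2)
    (D : Measure (X × Ypm)) [IsProbabilityMeasure D]
    (ρ : Measure H) [IsProbabilityMeasure ρ] :
    ∫ h, risk01 D (f h) ∂ρ =
      (1 / 2) * (∫ h, ∫ h', ∫ x, loss01 (f h x) (f h' x) ∂D.fst ∂ρ ∂ρ) +
        ∫ h, ∫ h', ∫ p, loss01 (f h p.1) p.2 * loss01 (f h' p.1) p.2 ∂D ∂ρ ∂ρ := by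
  have hm (h : H) : Measurable (f h) := hf.comp measurable_prodMk_left
  have hL : Measurable fun q : H × (X × Ypm) => loss01 (f q.1 q.2.1) q.2.2 :=
    (hf.comp (measurable_fst.prodMk measurable_snd.fst)).loss01 measurable_snd.snd
  have hLi (h : H) : Integrable (fun p : X × Ypm => loss01 (f h p.1) p.2) D :=
    integrable_of_mem_Icc (hL.comp measurable_prodMk_left)
      (fun _ => loss01_nonneg _ _) fun _ => loss01_le_one _ _
  have hJm : Measurable fun q : (H × H) × (X × Ypm) =>
      loss01 (f q.1.1 q.2.1) q.2.2 * loss01 (f q.1.2 q.2.1) q.2.2 :=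
    (hL.comp (measurable_fst.fst.prodMk measurable_snd)).mul
      (hL.comp (measurable_fst.snd.prodMk measurable_snd))
  have hJ0 (h h' : H) (p : X × Ypm) :
      0 ≤ loss01 (f h p.1) p.2 * loss01 (f h' p.1) p.2 :=
    mul_nonneg (loss01_nonneg _ _) (loss01_nonneg _ _)
  have hJ1 (h h' : H) (p : X × Ypm) :
      loss01 (f h p.1) p.2 * loss01 (f h' p.1) p.2 ≤ 1 :=
    mul_le_one₀ (loss01_le_one _ _) (loss01_nonneg _ _) (loss01_le_one _ _)
  have hJi (h h' : H) :
      Integrable (fun p : X × Ypm => loss01 (f h p.1) p.2 * loss01 (f h' p.1) p.2) D :=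
    integrable_of_mem_Icc (hJm.comp (measurable_prodMk_left (x := (h, h')))) (hJ0 h h') (hJ1 h h')
  have hR : Integrable (fun h => risk01 D (f h)) ρ :=
    (integrable_of_mem_Icc (μ := ρ.prod D) hL (fun _ => loss01_nonneg _ _)
      fun _ => loss01_le_one _ _).integral_prod_left
  have hJJ : Integrable (fun q : H × H =>
      ∫ p, loss01 (f q.1 p.1) p.2 * loss01 (f q.2 p.1) p.2 ∂D) (ρ.prod ρ) :=
    (integrable_of_mem_Icc (μ := (ρ.prod ρ).prod D) hJm (fun _ => hJ0 _ _ _)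
      fun _ => hJ1 _ _ _).integral_prod_left
  have hJh (h : H) : Integrable (fun h' =>
      ∫ p, loss01 (f h p.1) p.2 * loss01 (f h' p.1) p.2 ∂D) ρ :=
    (integrable_of_mem_Icc (μ := ρ.prod D)
      (hJm.comp ((measurable_const (a := h)).prodMk measurable_fst |>.prodMk measurable_snd))
      (fun _ => hJ0 _ _ _) fun _ => hJ1 _ _ _).integral_prod_left
  have hd (h h' : H) : ∫ x, loss01 (f h x) (f h' x) ∂D.fst =
      risk01 D (f h) + risk01 D (f h') -
        2 * ∫ p, loss01 (f h p.1) p.2 * loss01 (f h' p.1) p.2 ∂D := by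
    rw [Measure.fst, integral_map measurable_fst.aemeasurable
      ((hm h).loss01 (hm h')).aestronglyMeasurable, risk01, risk01,
      ← integral_add_sub_two_mul (hLi h) (hLi h') (hJi h h')]
    exact integral_congr_ae <| .of_forall fun p => loss01_eq_add_sub _ _ p.2
  have hdd (h : H) : ∫ h', ∫ x, loss01 (f h x) (f h' x) ∂D.fst ∂ρ =
      risk01 D (f h) + ∫ h', risk01 D (f h') ∂ρ -
        2 * ∫ h', ∫ p, loss01 (f h p.1) p.2 * loss01 (f h' p.1) p.2 ∂D ∂ρ := by
    simp_rw [hd]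
    rw [integral_add_sub_two_mul (integrable_const _) hR (hJh h)]
    simp
  simp_rw [hdd]
  rw [integral_add_sub_two_mul hR (integrable_const _) hJJ.integral_prod_left]
  simp only [integral_const, probReal_univ, one_smul]
  ring
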